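/- arXiv:2006.06255 — 4 statements merged into one kernel-verified Lean document; each statement's English description precedes it below -/
import Mathlib

section
/- Gate teleportation with an encrypted resource state: for every θ ∈ ℝ, every a, b ∈ {0,1}, every vector ψ ∈ ℂ² and every measurement outcome c ∈ {0,1}, there exists λ ∈ ℂ with |λ| = 1 such that (I ⊗ ⟨c|) applied to CNOT((X^a Z^b |A_θ⟩) ⊗ ψ) equals (λ/√2) · X^c · Z^b · A_{(-1)^{a⊕c} · θ} · ψ. Hence using the one-time-pad-encrypted state X^a Z^b |A_θ⟩ as the control of the teleportation circuit effects, up to a global phase and Pauli corrections, the gate A_{(-1)^{a⊕c}θ} on ψ. -/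
open Matrix Real

noncomputable def Xm : Matrix (Fin 2) (Fin 2) ℂ := !![0, 1; 1, 0]

noncomputable def Zm : Matrix (Fin 2) (Fin 2) ℂ := !![1, 0; 0, -1]

/-- The gate `A_θ = diag(1, e^{iθ})`. -/
noncomputable def Am (θ : ℝ) : Matrix (Fin 2) (Fin 2) ℂ :=
  !![1, 0; 0, Complex.exp (Complex.I * θ)]

/-- The state `|A_θ⟩ = (|0⟩ + e^{iθ}|1⟩)/√2`. -/
noncomputable def Aket (θ : ℝ) : Fin 2 → ℂ :=
  ![1 / (Real.sqrt 2 : ℂ), Complex.exp (Complex.I * θ) / (Real.sqrt 2 : ℂ)]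

/-- The tensor product of two qubit states. -/
noncomputable def tens (v w : Fin 2 → ℂ) : Fin 2 × Fin 2 → ℂ :=
  fun p => v p.1 * w p.2

/-- The CNOT gate with control on the first qubit, mapping `|a⟩⊗|b⟩` to `|a⟩⊗|a⊕b⟩`. -/
noncomputable def CNOT : Matrix (Fin 2 × Fin 2) (Fin 2 × Fin 2) ℂ :=
  fun p q => if p.1 = q.1 ∧ p.2 = q.1 + q.2 then 1 else 0

/-- The partial inner product `(I ⊗ ⟨c|)`, sending `v ⊗ w` to `⟨c|w⟩ · v`. -/
noncomputable def partialBra (c : Fin 2) (v : Fin 2 × Fin 2 → ℂ) : Fin 2 → ℂ :=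
  fun i => v (i, c)

/-- Gate teleportation with a one-time-pad-encrypted resource state:
up to a global phase `λ`, measuring outcome `c` effects `X^c Z^b A_{(-1)^{a⊕c} θ}` on `ψ`. -/
theorem gate_teleportation_encrypted (θ : ℝ) (a b : Fin 2) (ψ : Fin 2 → ℂ) (c : Fin 2) :
    ∃ lam : ℂ, ‖lam‖ = 1 ∧
      partialBra c (CNOT.mulVec (tens ((Xm ^ (a : ℕ) * Zm ^ (b : ℕ)).mulVec (Aket θ)) ψ))
        = (lam / (Real.sqrt 2 : ℂ)) •
            ((Xm ^ (c : ℕ) * Zm ^ (b : ℕ) *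
              Am ((-1 : ℝ) ^ (((a : ℕ) + (c : ℕ)) % 2) * θ)).mulVec ψ) := by
  have hn : ‖Complex.exp (Complex.I * θ)‖ = 1 := by
    rw [mul_comm]; exact Complex.norm_exp_ofReal_mul_I θ
  have he : Complex.exp (Complex.I * θ) ≠ 0 := Complex.exp_ne_zero _
  have hneg : Complex.exp (-(Complex.I * θ)) = (Complex.exp (Complex.I * θ))⁻¹ :=
    Complex.exp_neg _
  refine ⟨if a = c then 1 else (-1) ^ (b : ℕ) * Complex.exp (Complex.I * θ), ?_, ?_⟩
  · split_ifs
    · simp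
    · simp [hn]
  · ext i
    fin_cases a <;> fin_cases b <;> fin_cases c <;> fin_cases i <;>
      simp [partialBra, CNOT, tens, Xm, Zm, Am, Aket, Matrix.mulVec, dotProduct,
        Fintype.sum_prod_type, Fin.sum_univ_two, Matrix.mul_apply, hneg] <;>
      field_simp
end

section
/- The teleportation measurement outcome is uniformly random regardless of the gate and the input: for every θ ∈ ℝ, every a, b ∈ {0,1}, every unit vector ψ ∈ ℂ² and every outcome c ∈ {0,1}, the squared norm of (I ⊗ ⟨c|) CNOT((X^a Z^b |A_θ⟩) ⊗ ψ) equals 1/2. Hence the probability of each measurement outcome is 1/2 independently of θ, of the encryption keys a, b, and of ψ. -/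
open Matrix Real

theorem Aket_normSq (θ : ℝ) (i : Fin 2) : Complex.normSq (Aket θ i) = 1 / 2 := by
  have h2 : Complex.normSq (Real.sqrt 2 : ℂ) = 2 := by
    rw [Complex.normSq_ofReal]; exact Real.mul_self_sqrt (by norm_num)
  have he : Complex.normSq (Complex.exp (Complex.I * θ)) = 1 := by
    rw [Complex.normSq_eq_norm_sq, mul_comm, Complex.norm_exp_ofReal_mul_I]; norm_num
  fin_cases i
  · simp [Aket, h2]
  · simp [Aket, h2, he]

theorem enc_normSq (θ : ℝ) (a b i : Fin 2) :
    Complex.normSq ((Xm ^ (a : ℕ) * Zm ^ (b : ℕ)).mulVec (Aket θ) i) = 1 / 2 := by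
  have h0 := Aket_normSq θ 0
  have h1 := Aket_normSq θ 1
  fin_cases a <;> fin_cases b <;> fin_cases i <;>
    simp [Xm, Zm, Matrix.mulVec, dotProduct, Fin.sum_univ_two, Matrix.mul_apply] <;>
    first
    | simpa using h0
    | simpa using h1

theorem cnot_entry (v ψ : Fin 2 → ℂ) (i c : Fin 2) :
    partialBra c (CNOT.mulVec (tens v ψ)) i = v i * ψ (i + c) := by
  fin_cases i <;> fin_cases c <;>
    simp [partialBra, CNOT, tens, Matrix.mulVec, dotProduct, Fintype.sum_prod_type, Fin.sum_univ_two]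

/-- The teleportation measurement outcome is uniformly random: for a unit input `ψ`,
each outcome `c` occurs with probability `1/2`, independently of `θ`, `a`, `b`, `ψ`. -/
theorem teleportation_outcome_uniform (θ : ℝ) (a b : Fin 2) (ψ : Fin 2 → ℂ)
    (hψ : (∑ i, Complex.normSq (ψ i)) = 1) (c : Fin 2) :
    (∑ i, Complex.normSq
        (partialBra c
          (CNOT.mulVec (tens ((Xm ^ (a : ℕ) * Zm ^ (b : ℕ)).mulVec (Aket θ)) ψ)) i))
      = 1 / 2 := by
  simp only [cnot_entry, Complex.normSq_mul, enc_normSq]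
  rw [Fin.sum_univ_two] at hψ ⊢
  fin_cases c
  · simp
    linarith
  · simp
    linarith
end

section
/- Rotation axis of THTH (Table 1, row 1): T·H·T·H = e^{iπ/4} · ( cos²(π/8)·I − i·sin(π/8)·( cos(π/8)·X + sin(π/8)·Y + cos(π/8)·Z ) ) as 2×2 complex matrices. Hence, up to the global phase e^{iπ/4}, THTH is a Bloch-sphere rotation about the axis (cos(π/8), sin(π/8), cos(π/8)) through an angle δ with cos(δ/2) = cos²(π/8). -/
open Matrix Real

noncomputable def Ym : Matrix (Fin 2) (Fin 2) ℂ := !![0, -Complex.I; Complex.I, 0]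

noncomputable def Hm : Matrix (Fin 2) (Fin 2) ℂ :=
  (1 / (Real.sqrt 2 : ℂ)) • !![1, 1; 1, -1]

noncomputable def Tm : Matrix (Fin 2) (Fin 2) ℂ :=
  !![1, 0; 0, Complex.exp (Complex.I * (Real.pi / 4))]

/-- Rotation axis of `THTH`: up to the global phase `e^{iπ/4}`, it is a Bloch-sphere
rotation about `(cos(π/8), sin(π/8), cos(π/8))` with `cos(δ/2) = cos²(π/8)`. -/
theorem THTH_rotation_axis :
    Tm * Hm * Tm * Hm
      = Complex.exp (Complex.I * (Real.pi / 4)) •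
          (((Real.cos (Real.pi / 8) ^ 2 : ℝ) : ℂ) • (1 : Matrix (Fin 2) (Fin 2) ℂ)
            - (Complex.I * ((Real.sin (Real.pi / 8) : ℝ) : ℂ)) •
              (((Real.cos (Real.pi / 8) : ℝ) : ℂ) • Xm
                + ((Real.sin (Real.pi / 8) : ℝ) : ℂ) • Ym
                + ((Real.cos (Real.pi / 8) : ℝ) : ℂ) • Zm)) := by
  have hw : Complex.exp (Complex.I * (Real.pi / 4))
      = (((Real.cos (Real.pi / 8) : ℝ) : ℂ)
          + Complex.I * ((Real.sin (Real.pi / 8) : ℝ) : ℂ)) ^ 2 := by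
    have h : Complex.I * ((Real.pi : ℂ) / 4)
        = ((2 : ℕ) : ℂ) * (((Real.pi / 8 : ℝ) : ℂ) * Complex.I) := by
      push_cast; ring
    rw [h, Complex.exp_nat_mul, Complex.exp_mul_I, Complex.ofReal_cos, Complex.ofReal_sin]
    ring
  have hcs : ((Real.cos (Real.pi / 8) : ℝ) : ℂ) ^ 2
      + ((Real.sin (Real.pi / 8) : ℝ) : ℂ) ^ 2 = 1 := by
    rw [← Complex.ofReal_pow, ← Complex.ofReal_pow, ← Complex.ofReal_add,
      Real.cos_sq_add_sin_sq, Complex.ofReal_one]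
  have hr : (1 / (Real.sqrt 2 : ℂ)) ^ 2 = 1 / 2 := by
    rw [div_pow, ← Complex.ofReal_pow, Real.sq_sqrt (by norm_num)]
    norm_num
  have hI : Complex.I ^ 2 = -1 := Complex.I_sq
  rw [Complex.ofReal_pow]
  unfold Tm Hm Xm Ym Zm
  rw [hw]
  generalize ((Real.cos (Real.pi / 8) : ℝ) : ℂ) = c at *
  generalize ((Real.sin (Real.pi / 8) : ℝ) : ℂ) = s at *
  generalize (1 / (Real.sqrt 2 : ℂ)) = r at *
  clear hw
  generalize Complex.I = j at *
  ext a b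
  fin_cases a <;> fin_cases b <;>
    simp [Matrix.mul_apply, Fin.sum_univ_two]
  all_goals grind
end

section
/- Rotation axis of HTHT and its parallelism with T†HT†H: H·T·H·T = e^{iπ/4} · ( cos²(π/8)·I − i·sin(π/8)·( cos(π/8)·X − sin(π/8)·Y + cos(π/8)·Z ) ) as 2×2 complex matrices; consequently the rotation axis (cos(π/8), −sin(π/8), cos(π/8)) of HTHT is parallel (anti-parallel) to the rotation axis (−cos(π/8), sin(π/8), −cos(π/8)) of T†HT†H, i.e. the two axis vectors are scalar multiples of each other. -/
open Matrix Real

/-- Rotation axis of `HTHT` and its (anti-)parallelism with that of `T†HT†H`: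
`HTHT` is, up to the phase `e^{iπ/4}`, a rotation about `(cos(π/8), −sin(π/8), cos(π/8))`,
and this axis is a scalar multiple of the axis `(−cos(π/8), sin(π/8), −cos(π/8))`
of `T†HT†H`. -/
theorem HTHT_rotation_axis_parallel :
    (Hm * Tm * Hm * Tm
      = Complex.exp (Complex.I * (Real.pi / 4)) •
          (((Real.cos (Real.pi / 8) ^ 2 : ℝ) : ℂ) • (1 : Matrix (Fin 2) (Fin 2) ℂ)
            - (Complex.I * ((Real.sin (Real.pi / 8) : ℝ) : ℂ)) •
              (((Real.cos (Real.pi / 8) : ℝ) : ℂ) • Xm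
                + ((-Real.sin (Real.pi / 8) : ℝ) : ℂ) • Ym
                + ((Real.cos (Real.pi / 8) : ℝ) : ℂ) • Zm))) ∧
    (∃ r : ℝ,
      ![-Real.cos (Real.pi / 8), Real.sin (Real.pi / 8), -Real.cos (Real.pi / 8)]
        = r • ![Real.cos (Real.pi / 8), -Real.sin (Real.pi / 8), Real.cos (Real.pi / 8)]) := by
  refine ⟨?_, -1, by simp⟩
  have hw : Complex.exp (Complex.I * (Real.pi / 4))
      = (((Real.cos (Real.pi / 8) : ℝ) : ℂ)
        + ((Real.sin (Real.pi / 8) : ℝ) : ℂ) * Complex.I) ^ 2 := by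
    rw [Complex.ofReal_cos, Complex.ofReal_sin, ← Complex.exp_mul_I, ← Complex.exp_nat_mul]
    congr 1
    push_cast
    ring
  have h1 : ((Real.cos (Real.pi / 8) : ℝ) : ℂ) ^ 2 + ((Real.sin (Real.pi / 8) : ℝ) : ℂ) ^ 2 = 1 := by
    exact_mod_cast Real.cos_sq_add_sin_sq (Real.pi / 8)
  have hI : Complex.I ^ 2 = -1 := Complex.I_sq
  have h2 : (1 / (Real.sqrt 2 : ℂ)) ^ 2 = 1 / 2 := by
    rw [div_pow, ← Complex.ofReal_pow, Real.sq_sqrt (by norm_num)]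
    norm_num
  unfold Hm Tm Xm Ym Zm
  rw [hw, Complex.ofReal_pow, Complex.ofReal_neg]
  generalize ((Real.cos (Real.pi / 8) : ℝ) : ℂ) = c at *
  generalize ((Real.sin (Real.pi / 8) : ℝ) : ℂ) = s at *
  generalize (1 / (Real.sqrt 2 : ℂ)) = q at *
  generalize Complex.I = j at *
  clear hw
  ext a b
  fin_cases a <;> fin_cases b <;>
    simp [Matrix.mul_apply, Fin.sum_univ_two] <;> grind
end
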